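/- arXiv:1711.04724 — 2 statements merged into one kernel-verified Lean document; each statement's English description precedes it below -/
import Mathlib

section
/- Let A be a standard C*-algebra on a Hilbert space H, let E and F be inner product A-modules, and let T, S : E → F be two nonzero local mappings such that for all x, y ∈ E, ⟨x, y⟩ = 0 implies ⟨T(x), S(y)⟩ = 0. Then there exists γ ∈ ℂ such that ⟨T(x), S(y)⟩ = γ·⟨x, y⟩ for all x, y ∈ E; moreover, T and S are A-linear. -/
/-- An inner product module over a C*-algebra `A`: a (left) `A`-module `E` together with an
`A`-valued inner product which is `ℂ`-linear and `A`-linear in the first variable, conjugate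
symmetric, and positive definite. -/
structure CStarInnerProductModule (A E : Type*) [NonUnitalCStarAlgebra A]
    [PartialOrder A] [StarOrderedRing A]
    [AddCommGroup E] [Module ℂ E] [SMul A E] where
  inner : E → E → A
  add_left : ∀ x y z : E, inner (x + y) z = inner x z + inner y z
  smulC_left : ∀ (c : ℂ) (x y : E), inner (c • x) y = c • inner x y
  smulA_left : ∀ (a : A) (x y : E), inner (a • x) y = a * inner x y
  star_inner : ∀ x y : E, star (inner x y) = inner y x
  inner_self_nonneg : ∀ x : E, 0 ≤ inner x x
  inner_self_eq_zero : ∀ x : E, inner x x = 0 ↔ x = 0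
  smul_add : ∀ (a : A) (x y : E), a • (x + y) = a • x + a • y
  add_smul : ∀ (a b : A) (x : E), (a + b) • x = a • x + b • x
  mul_smul : ∀ (a b : A) (x : E), (a * b) • x = a • (b • x)
  smul_assoc : ∀ (c : ℂ) (a : A) (x : E), (c • a) • x = c • (a • x)

/-- A pair of sesquilinear forms such that the second vanishes wherever the first does is
proportional. -/
theorem exists_eq_mul_of_sesquilin_eq_zero_imp {V : Type*} [AddCommGroup V] [Module ℂ V]
    (φ ψ : V →ₗ[ℂ] V →ₗ⋆[ℂ] ℂ) (h : ∀ x y, φ x y = 0 → ψ x y = 0) :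
    ∃ γ : ℂ, ∀ x y, ψ x y = γ * φ x y := by
  have left (x z y : V) : φ z y * ψ x y = φ x y * ψ z y := by
    have := h (φ z y • x - φ x y • z) y (by simp [mul_comm])
    simpa [sub_eq_zero] using this
  have right (x y z : V) : φ x z * ψ x y = φ x y * ψ x z := by
    have := h x (star (φ x z) • y - star (φ x y) • z) (by simp [mul_comm])
    simpa [sub_eq_zero] using this
  by_cases h0 : ∀ x y, φ x y = 0
  · exact ⟨0, fun x y => by simp [h x y (h0 x y)]⟩
  push Not at h0
  obtain ⟨x₀, y₀, h0⟩ := h0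
  have of_ne (x y : V) (hy : φ x₀ y ≠ 0) : ψ x y = ψ x₀ y₀ / φ x₀ y₀ * φ x y := by
    apply mul_left_cancel₀ hy
    rw [left x x₀ y]
    have := right x₀ y y₀
    field_simp
    linear_combination φ x y * this
  refine ⟨ψ x₀ y₀ / φ x₀ y₀, fun x y => ?_⟩
  by_cases hy : φ x₀ y = 0
  · have h1 := of_ne x (y + y₀) (by simpa [hy] using h0)
    have h2 := of_ne x y₀ h0
    rw [map_add, map_add] at h1
    linear_combination h1 - h2
  · exact of_ne x y hy

namespace CStarInnerProductModule

variable {A E F : Type*} [NonUnitalCStarAlgebra A] [PartialOrder A] [StarOrderedRing A]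
  [AddCommGroup E] [Module ℂ E] [SMul A E] [AddCommGroup F] [Module ℂ F] [SMul A F]

theorem smul_sub (M : CStarInnerProductModule A E) (a : A) (x y : E) :
    a • (x - y) = a • x - a • y := by
  rw [eq_sub_iff_add_eq, ← M.smul_add, sub_add_cancel]

theorem sub_smul (M : CStarInnerProductModule A E) (a b : A) (x : E) :
    (a - b) • x = a • x - b • x := by
  rw [eq_sub_iff_add_eq, ← M.add_smul, sub_add_cancel]

theorem add_right (M : CStarInnerProductModule A E) (x y z : E) :
    M.inner x (y + z) = M.inner x y + M.inner x z := by
  rw [← M.star_inner, M.add_left, star_add, M.star_inner, M.star_inner]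

theorem smulC_right (M : CStarInnerProductModule A E) (c : ℂ) (x y : E) :
    M.inner x (c • y) = star c • M.inner x y := by
  rw [← M.star_inner, M.smulC_left, star_smul, M.star_inner]

theorem smulA_right (M : CStarInnerProductModule A E) (a : A) (x y : E) :
    M.inner x (a • y) = M.inner x y * star a := by
  rw [← M.star_inner, M.smulA_left, star_mul, M.star_inner]

theorem inner_smul_smul (M : CStarInnerProductModule A E) (a b : A) (x y : E) :
    M.inner (a • x) (b • y) = a * M.inner x y * star b := by
  rw [M.smulA_left, M.smulA_right, mul_assoc]

theorem mul_inner_eq_zero (M : CStarInnerProductModule A E) {a : A} {x : E} (h : a • x = 0)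
    (y : E) : a * M.inner x y = 0 := by
  have h0 := M.smulC_left 0 x y
  rw [zero_smul, zero_smul] at h0
  rw [← M.smulA_left, h, h0]

theorem eq_zero_of_forall_smul_eq_zero (M : CStarInnerProductModule A E) {x : E}
    (h : ∀ a : A, a • x = 0) : x = 0 := by
  rw [← M.inner_self_eq_zero, ← CStarRing.star_mul_self_eq_zero_iff]
  exact M.mul_inner_eq_zero (h _) x

/-- A local map commutes with the action of idempotents. -/
theorem map_smul_of_isIdempotentElem (ME : CStarInnerProductModule A E)
    (MF : CStarInnerProductModule A F) (T : E →ₗ[ℂ] F)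
    (hT : ∀ (a : A) (x : E), a • x = 0 → a • T x = 0) {p : A} (hp : IsIdempotentElem p) (x : E) :
    T (p • x) = p • T x := by
  have h1 : p • T x = p • T (p • x) := by
    have := hT p (x - p • x) (by rw [ME.smul_sub, ← ME.mul_smul, hp.eq, sub_self])
    rwa [map_sub, MF.smul_sub, sub_eq_zero] at this
  rw [h1, ← sub_eq_zero]
  refine MF.eq_zero_of_forall_smul_eq_zero fun a => ?_
  have := hT (a - a * p) (p • x)
    (by rw [ME.sub_smul, ← ME.mul_smul, ← ME.mul_smul, mul_assoc, hp.eq, sub_self])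
  rwa [MF.sub_smul, MF.mul_smul, ← MF.smul_sub] at this

variable {H : Type*} [NormedAddCommGroup H] [InnerProductSpace ℂ H]

open InnerProductSpace (rankOne)

/-- A local map commutes with the action of rank-one operators. -/
theorem map_smul_of_eq_rankOne (ME : CStarInnerProductModule A E)
    (MF : CStarInnerProductModule A F) [CompleteSpace H] {π : A →⋆ₙₐ[ℂ] (H →L[ℂ] H)}
    (hπ : Function.Injective π) {R : H → H → A} (hR : ∀ ξ η, π (R ξ η) = rankOne ℂ ξ η)
    (T : E →ₗ[ℂ] F) (hT : ∀ (a : A) (x : E), a • x = 0 → a • T x = 0) (ξ η : H) (x : E) :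
    T (R ξ η • x) = R ξ η • T x := by
  have of_ne (ξ η : H) (h : Inner.inner ℂ η ξ ≠ 0) : T (R ξ η • x) = R ξ η • T x := by
    have hp : IsIdempotentElem ((Inner.inner ℂ η ξ)⁻¹ • R ξ η) := by
      apply hπ
      ext z
      simp only [map_mul, map_smul, hR, mul_apply_eq_comp,
        _root_.smul_apply, InnerProductSpace.rankOne_apply,
        smul_smul]
      congr 1
      field_simp
    have := ME.map_smul_of_isIdempotentElem MF T hT hp x
    rw [ME.smul_assoc, MF.smul_assoc, map_smul] at this
    exact smul_right_injective F (inv_ne_zero h) this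
  by_cases hξ : ξ = 0
  · have h0 : R ξ η = 0 := hπ (by simp [hR, hξ])
    rw [h0]
    exact ME.map_smul_of_isIdempotentElem MF T hT IsIdempotentElem.zero x
  by_cases h : Inner.inner ℂ η ξ = 0
  · have hsub : R ξ η = R ξ (η + ξ) - R ξ ξ := hπ (by simp [hR])
    rw [hsub, ME.sub_smul, MF.sub_smul, map_sub, of_ne ξ ξ (by simpa using hξ),
      of_ne ξ (η + ξ) (by simpa [inner_add_left, h] using hξ)]
  · exact of_ne ξ η h

/-- A local map between inner product modules over a standard C*-algebra is module linear. -/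
theorem map_smul_of_local (ME : CStarInnerProductModule A E)
    (MF : CStarInnerProductModule A F) [CompleteSpace H] {π : A →⋆ₙₐ[ℂ] (H →L[ℂ] H)}
    (hπ : Function.Injective π) {R : H → H → A} (hR : ∀ ξ η, π (R ξ η) = rankOne ℂ ξ η)
    (T : E →ₗ[ℂ] F) (hT : ∀ (a : A) (x : E), a • x = 0 → a • T x = 0) (a : A) (x : E) :
    T (a • x) = a • T x := by
  have hRT := ME.map_smul_of_eq_rankOne MF hπ hR T hT
  have hmul (ξ η : H) : R ξ η * a = R ξ (star (π a) η) := by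
    apply hπ
    ext z
    simp [hR, ContinuousLinearMap.star_eq_adjoint, ContinuousLinearMap.adjoint_inner_left]
  rw [← sub_eq_zero, ← MF.inner_self_eq_zero]
  apply hπ
  ext z
  rw [map_zero, _root_.zero_apply, ← _root_.inner_self_eq_zero (𝕜 := ℂ)]
  set d := T (a • x) - a • T x
  set ξ := π (MF.inner d d) z
  have hd : R ξ ξ • d = 0 := by
    rw [MF.smul_sub, ← hRT, ← ME.mul_smul, ← MF.mul_smul, hmul, hRT, sub_self]
  have h := congrArg (fun b => π b z) (MF.mul_inner_eq_zero hd d)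
  simpa [hR, ξ] using h

end CStarInnerProductModule

/-- **Theorem 3.8**: let `A` be a standard C*-algebra on a Hilbert space `H` (realized via an
isometric star homomorphism `π : A → B(H)` whose range contains all compact operators), let
`E, F` be inner product `A`-modules, and let `T, S : E → F` be two nonzero local mappings
(`ℂ`-linear, and `a • x = 0` implies `a • T x = 0`) such that `⟪x, y⟫ = 0` implies
`⟪T x, S y⟫ = 0`.  Then there is `γ ∈ ℂ` with `⟪T x, S y⟫ = γ • ⟪x, y⟫` for all `x, y ∈ E`;
moreover `T` and `S` are `A`-linear. -/
theorem standard_orthogonality_preserving_local_pair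
    {H : Type*} [NormedAddCommGroup H] [InnerProductSpace ℂ H] [CompleteSpace H]
    {A E F : Type*} [NonUnitalCStarAlgebra A] [PartialOrder A] [StarOrderedRing A]
    (π : A →⋆ₙₐ[ℂ] (H →L[ℂ] H)) (hπ : Isometry π)
    (hcpt : ∀ f : H →L[ℂ] H, IsCompactOperator (⇑f) → f ∈ Set.range π)
    [AddCommGroup E] [Module ℂ E] [SMul A E]
    [AddCommGroup F] [Module ℂ F] [SMul A F]
    (ME : CStarInnerProductModule A E) (MF : CStarInnerProductModule A F)
    (T S : E → F) (hT : T ≠ 0) (hS : S ≠ 0)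
    (hTadd : ∀ x y : E, T (x + y) = T x + T y)
    (hTsmulC : ∀ (c : ℂ) (x : E), T (c • x) = c • T x)
    (hTlocal : ∀ (a : A) (x : E), a • x = 0 → a • T x = 0)
    (hSadd : ∀ x y : E, S (x + y) = S x + S y)
    (hSsmulC : ∀ (c : ℂ) (x : E), S (c • x) = c • S x)
    (hSlocal : ∀ (a : A) (x : E), a • x = 0 → a • S x = 0)
    (hTS : ∀ x y : E, ME.inner x y = 0 → MF.inner (T x) (S y) = 0) :
    (∃ γ : ℂ, ∀ x y : E, MF.inner (T x) (S y) = γ • ME.inner x y) ∧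
      (∀ (a : A) (x : E), T (a • x) = a • T x) ∧
      (∀ (a : A) (x : E), S (a • x) = a • S x) := by
  have hinj := hπ.injective
  choose R hR using fun ξ η : H =>
    hcpt (InnerProductSpace.rankOne ℂ ξ η) <|
      (isCompactOperator_of_locallyCompactSpace_dom (innerSL ℂ η)).clm_comp
        (ContinuousLinearMap.toSpanSingleton ℂ ξ)
  have hTA := ME.map_smul_of_local MF hinj hR
    { toFun := T, map_add' := hTadd, map_smul' := hTsmulC } hTlocal
  have hSA := ME.map_smul_of_local MF hinj hR
    { toFun := S, map_add' := hSadd, map_smul' := hSsmulC } hSlocal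
  simp only [LinearMap.coe_mk, AddHom.coe_mk] at hTA hSA
  refine ⟨?_, hTA, hSA⟩
  rcases subsingleton_or_nontrivial H with hH | hH
  · exact ⟨0, fun x y => hinj (Subsingleton.elim _ _)⟩
  obtain ⟨ξ, hξ⟩ := exists_norm_eq H zero_le_one
  have hsandwich (η ζ : H) (a : A) :
      R ξ η * a * star (R ξ ζ) = inner ℂ η (π a ζ) • R ξ ξ := by
    apply hinj
    ext z
    simp [hR, map_star, ContinuousLinearMap.star_eq_adjoint, smul_smul,
      mul_comm]
  let φ : E →ₗ[ℂ] E →ₗ⋆[ℂ] ℂ := LinearMap.mk₂'ₛₗ _ _ (fun x y => inner ℂ ξ (π (ME.inner x y) ξ))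
    (by simp [ME.add_left]) (by simp [ME.smulC_left])
    (by simp [ME.add_right]) (by simp [ME.smulC_right])
  let ψ : E →ₗ[ℂ] E →ₗ⋆[ℂ] ℂ := LinearMap.mk₂'ₛₗ _ _
    (fun x y => inner ℂ ξ (π (MF.inner (T x) (S y)) ξ))
    (by simp [hTadd, MF.add_left])
    (by simp [hTsmulC, MF.smulC_left])
    (by simp [hSadd, MF.add_right])
    (by simp [hSsmulC, MF.smulC_right])
  have hφ (x y : E) : φ x y = inner ℂ ξ (π (ME.inner x y) ξ) := rfl
  have hψ (x y : E) : ψ x y = inner ℂ ξ (π (MF.inner (T x) (S y)) ξ) := rfl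
  have hcoeff (η ζ : H) (a : A) :
      inner ℂ ξ (π (R ξ η * a * star (R ξ ζ)) ξ) = inner ℂ η (π a ζ) := by
    simp [hsandwich, hR, hξ]
  obtain ⟨γ, hγ⟩ := exists_eq_mul_of_sesquilin_eq_zero_imp φ ψ fun x y hxy => by
    have := hTS (R ξ ξ • x) (R ξ ξ • y) (by
      rw [ME.inner_smul_smul, hsandwich, ← hφ, hxy, zero_smul])
    rw [hTA, hSA, MF.inner_smul_smul] at this
    rw [hψ, ← hcoeff, this]
    simp
  refine ⟨γ, fun x y => hinj ?_⟩
  ext ζ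
  refine ext_inner_left ℂ fun η => ?_
  have := hγ (R ξ η • x) (R ξ ζ • y)
  rw [hφ, hψ, hTA, hSA, MF.inner_smul_smul, ME.inner_smul_smul, hcoeff, hcoeff] at this
  simpa [inner_smul_right] using this
end

section
/- Let A be a C*-algebra and let E be a full Hilbert A-module. Let T : E → E be a bounded A-linear map such that for all x, y ∈ E, ⟨x, y⟩ = 0 implies ⟨T(x), y⟩ = 0. Then there exists an element γ of the center Z(M(A)) of the multiplier algebra M(A) of A such that ⟨T(x), y⟩ = γ·⟨x, y⟩ for all x, y ∈ E (equivalently, T acts as multiplication by the central multiplier γ). -/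
open MultiplierAlgebra

/-- A Hilbert module over a C*-algebra `A`: a (left) `A`-module `E` together with an `A`-valued
inner product which is `ℂ`-linear and `A`-linear in the first variable, conjugate symmetric and
positive definite, such that the norm of `E` is the induced norm `‖x‖ = ‖⟪x, x⟫‖^(1/2)`
(completeness is the type class `CompleteSpace E`). -/
structure CStarNormedInnerProductModule (A E : Type*) [NonUnitalCStarAlgebra A]
    [PartialOrder A] [StarOrderedRing A]
    [NormedAddCommGroup E] [Module ℂ E] [SMul A E] where
  inner : E → E → A
  add_left : ∀ x y z : E, inner (x + y) z = inner x z + inner y z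
  smulC_left : ∀ (c : ℂ) (x y : E), inner (c • x) y = c • inner x y
  smulA_left : ∀ (a : A) (x y : E), inner (a • x) y = a * inner x y
  star_inner : ∀ x y : E, star (inner x y) = inner y x
  inner_self_nonneg : ∀ x : E, 0 ≤ inner x x
  inner_self_eq_zero : ∀ x : E, inner x x = 0 ↔ x = 0
  smul_add : ∀ (a : A) (x y : E), a • (x + y) = a • x + a • y
  add_smul : ∀ (a b : A) (x : E), (a + b) • x = a • x + b • x
  mul_smul : ∀ (a b : A) (x : E), (a * b) • x = a • (b • x)
  smul_assoc : ∀ (c : ℂ) (a : A) (x : E), (c • a) • x = c • (a • x)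
  norm_eq : ∀ x : E, ‖x‖ ^ 2 = ‖inner x x‖

/-- A Hilbert C*-module is *full* when the closed linear span of all inner products is the
whole coefficient algebra. -/
def CStarNormedInnerProductModule.IsFull {A E : Type*} [NonUnitalCStarAlgebra A]
    [PartialOrder A] [StarOrderedRing A] [NormedAddCommGroup E] [Module ℂ E] [SMul A E]
    (M : CStarNormedInnerProductModule A E) : Prop :=
  (Submodule.span ℂ {a : A | ∃ x y : E, a = M.inner x y}).topologicalClosure = ⊤

open Filter Topology

section Locality

/-- The continuous ramp which is `0` on `(-∞, i]`, `1` on `[i + 1, ∞)` and affine in between. -/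
noncomputable def ramp (i : ℕ) (t : ℝ) : ℝ := max 0 (min 1 (t - i))

lemma continuous_ramp (i : ℕ) : Continuous (ramp i) := by unfold ramp; fun_prop

lemma ramp_zero (i : ℕ) : ramp i 0 = 0 := by simp [ramp]

lemma ramp_nonneg (i : ℕ) (t : ℝ) : 0 ≤ ramp i t := le_max_left _ _

lemma ramp_le_one (i : ℕ) (t : ℝ) : ramp i t ≤ 1 := by simp [ramp]

lemma ramp_mul_ramp_succ (i : ℕ) (t : ℝ) : ramp i t * ramp (i + 1) t = ramp (i + 1) t := by
  unfold ramp
  push_cast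
  rcases le_total t (i + 1) with h | h
  · rw [max_eq_left (b := min 1 (t - (i + 1))) ((min_le_right _ _).trans (by linarith)), mul_zero]
  · rw [min_eq_left (b := t - i) (by linarith), max_eq_right zero_le_one, one_mul]

lemma ramp_sub_mul_ramp_sub {i j : ℕ} (hij : i + 2 ≤ j) (t : ℝ) :
    (ramp i t - ramp (i + 1) t) * (ramp j t - ramp (j + 1) t) = 0 := by
  have hij' : (i : ℝ) + 2 ≤ j := by exact_mod_cast hij
  unfold ramp
  push_cast
  rcases le_total t j with h | h
  · rw [max_eq_left (b := min 1 (t - j)) ((min_le_right _ _).trans (by linarith)),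
      max_eq_left (b := min 1 (t - (j + 1))) ((min_le_right _ _).trans (by linarith))]
    simp
  · rw [min_eq_left (b := t - i) (by linarith), min_eq_left (b := t - (i + 1)) (by linarith)]
    simp

lemma sum_ramp (n : ℕ) {t : ℝ} (ht : 0 ≤ t) : ∑ i ∈ Finset.range n, ramp i t = min t n := by
  induction n with
  | zero => simp [ht]
  | succ n ih =>
    rw [Finset.sum_range_succ, ih]
    unfold ramp
    push_cast
    grind

variable {A : Type*} [NonUnitalCStarAlgebra A]

/-- Summing `n` terms of norm at most `K`, only neighbouring ones of which overlap, gives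
an element of norm `O(√n)`. -/
lemma norm_sum_sq_le_of_mul_star_eq_zero {x : ℕ → A} {K : ℝ} (hK : ∀ i, ‖x i‖ ≤ K)
    (hx : ∀ i j, i + 2 ≤ j → x i * star (x j) = 0) (n : ℕ) :
    ‖∑ i ∈ Finset.range n, x i‖ ^ 2 ≤ 3 * n * K ^ 2 := by
  have hK0 : 0 ≤ K := (norm_nonneg _).trans (hK 0)
  have hmul : ∀ i j, ‖x i * star (x j)‖ ≤ K ^ 2 := fun i j ↦ by
    calc ‖x i * star (x j)‖ ≤ ‖x i‖ * ‖star (x j)‖ := norm_mul_le _ _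
      _ ≤ K * K := by rw [norm_star]; gcongr <;> exact hK _
      _ = K ^ 2 := by ring
  induction n with
  | zero => simp
  | succ n ih =>
    set X := ∑ i ∈ Finset.range n, x i with hX
    have hcross : ‖X * star (x n)‖ ≤ K ^ 2 := by
      cases n with
      | zero => simp [hX]; positivity
      | succ m =>
        rw [hX, Finset.sum_range_succ, add_mul, Finset.sum_mul,
          Finset.sum_eq_zero fun i hi ↦ hx i _ (by have := Finset.mem_range.1 hi; omega), zero_add]
        exact hmul _ _
    have hcross' : ‖x n * star X‖ ≤ K ^ 2 := by
      rw [← norm_star, star_mul, star_star]; exact hcross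
    rw [Finset.sum_range_succ, ← hX, sq, ← CStarRing.norm_self_mul_star, star_add, add_mul, mul_add,
      mul_add]
    rw [sq, ← CStarRing.norm_self_mul_star] at ih
    calc _ ≤ (‖X * star X‖ + ‖X * star (x n)‖) + (‖x n * star X‖ + ‖x n * star (x n)‖) :=
          (norm_add_le _ _).trans (add_le_add (norm_add_le _ _) (norm_add_le _ _))
      _ ≤ (3 * n * K ^ 2 + K ^ 2) + (K ^ 2 + K ^ 2) := by
          gcongr; exact hmul _ _
      _ = _ := by push_cast; ring

lemma norm_sum_sq_le_of_star_mul_eq_zero {x : ℕ → A} {K : ℝ} (hK : ∀ i, ‖x i‖ ≤ K)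
    (hx : ∀ i j, i + 2 ≤ j → star (x i) * x j = 0) (n : ℕ) :
    ‖∑ i ∈ Finset.range n, x i‖ ^ 2 ≤ 3 * n * K ^ 2 := by
  have := norm_sum_sq_le_of_mul_star_eq_zero (x := fun i ↦ star (x i)) (K := K)
    (by simpa using hK) (by simpa using hx) n
  rwa [← star_sum, norm_star] at this

lemma eq_zero_of_forall_mul_eq_zero {z : A} (h : ∀ b : A, b * z = 0) : z = 0 :=
  CStarRing.star_mul_self_eq_zero_iff z |>.1 (h _)

lemma eq_zero_of_forall_mul_eq_zero' {z : A} (h : ∀ b : A, z * b = 0) : z = 0 :=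
  CStarRing.mul_star_self_eq_zero_iff z |>.1 (h _)

variable [PartialOrder A] [StarOrderedRing A]

/-- A positive element of norm at most `δ * m` is `δ` times a sum of `m` contractions `f i` of
which `f i` is a unit for `f (i + 1)`, and whose successive differences only overlap with their
neighbours. -/
lemma exists_ramp_decomposition {h : A} (hh : 0 ≤ h) {δ : ℝ} (hδ : 0 < δ) (m : ℕ)
    (hm : ‖h‖ ≤ δ * m) :
    ∃ f : ℕ → A, (∀ i, star (f i) = f i) ∧ (∀ i, ‖f i‖ ≤ 1) ∧
      (∀ i, f i * f (i + 1) = f (i + 1)) ∧ (∀ i, ‖f i - f (i + 1)‖ ≤ 1) ∧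
      (∀ i j, i + 2 ≤ j → (f i - f (i + 1)) * (f j - f (j + 1)) = 0) ∧
      (∀ i, f i * h = h * f i) ∧ h = δ • ∑ i ∈ Finset.range m, f i := by
  have hsa : IsSelfAdjoint h := .of_nonneg hh
  have hc : ∀ i, Continuous fun t : ℝ ↦ ramp i (t / δ) := fun i ↦
    (continuous_ramp i).comp (by fun_prop)
  have h0 : ∀ i, ramp i (0 / δ) = 0 := fun i ↦ by rw [zero_div, ramp_zero]
  have hsub : ∀ i, cfcₙ (fun t : ℝ ↦ ramp i (t / δ)) h - cfcₙ (fun t : ℝ ↦ ramp (i + 1) (t / δ)) h =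
      cfcₙ (fun t : ℝ ↦ ramp i (t / δ) - ramp (i + 1) (t / δ)) h := fun i ↦
    (cfcₙ_sub _ _ h (hc _).continuousOn (h0 _) (hc _).continuousOn (h0 _)).symm
  refine ⟨fun i ↦ cfcₙ (fun t : ℝ ↦ ramp i (t / δ)) h, fun i ↦ ?_, fun i ↦ ?_, fun i ↦ ?_,
    fun i ↦ ?_, fun i j hij ↦ ?_, fun i ↦ ?_, ?_⟩
  · exact (cfcₙ_predicate (R := ℝ) _ h : IsSelfAdjoint _)
  · refine norm_cfcₙ_le fun t _ ↦ ?_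
    rw [Real.norm_of_nonneg (ramp_nonneg _ _)]
    exact ramp_le_one _ _
  · dsimp only
    rw [← cfcₙ_mul _ _ h (hc _).continuousOn (h0 _) (hc _).continuousOn (h0 _)]
    simp only [ramp_mul_ramp_succ]
  · dsimp only
    rw [hsub]
    refine norm_cfcₙ_le fun t _ ↦ ?_
    rw [Real.norm_eq_abs, abs_sub_le_iff]
    constructor <;> linarith [ramp_nonneg i (t / δ), ramp_nonneg (i + 1) (t / δ),
      ramp_le_one i (t / δ), ramp_le_one (i + 1) (t / δ)]
  · have hc' : ∀ i, Continuous fun t : ℝ ↦ ramp i (t / δ) - ramp (i + 1) (t / δ) := fun i ↦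
      (hc i).sub (hc (i + 1))
    dsimp only
    rw [hsub, hsub, ← cfcₙ_mul _ _ h (hc' i).continuousOn (by simp only [h0, sub_self])
      (hc' j).continuousOn (by simp only [h0, sub_self])]
    simp only [ramp_sub_mul_ramp_sub hij]
    exact cfcₙ_const_zero ℝ h
  · have := cfcₙ_commute_cfcₙ (fun t : ℝ ↦ ramp i (t / δ)) (fun t : ℝ ↦ t) h
    rwa [cfcₙ_id' ℝ h] at this
  · have hsum := cfcₙ_sum (fun i t ↦ ramp i (t / δ)) h (Finset.range m)
      (fun i _ ↦ (hc i).continuousOn) (fun i _ ↦ h0 i)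
    have hcs : Continuous (∑ i ∈ Finset.range m, fun t : ℝ ↦ ramp i (t / δ)) := by
      rw [Finset.sum_fn]
      exact continuous_finsetSum _ fun i _ ↦ hc i
    have hsmul := cfcₙ_smul δ _ h hcs.continuousOn
      (by rw [Finset.sum_apply]; exact Finset.sum_eq_zero fun i _ ↦ h0 i)
    dsimp only
    rw [← hsum, ← hsmul]
    conv_lhs => rw [← cfcₙ_id' ℝ h]
    refine cfcₙ_congr fun t ht ↦ ?_
    have ht0 : 0 ≤ t := quasispectrum_nonneg_of_nonneg h hh t ht
    have ht1 : t ≤ ‖h‖ := by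
      have := norm_apply_le_norm_cfcₙ (fun t : ℝ ↦ t) h ht
      rw [cfcₙ_id' ℝ h] at this
      exact (le_abs_self t).trans this
    rw [Finset.sum_apply, sum_ramp _ (by positivity), min_eq_left, smul_eq_mul,
      mul_div_cancel₀ _ hδ.ne']
    rw [div_le_iff₀ hδ]
    linarith

lemma norm_mul_sub_mul_le_of_local {h k : A} (hh : 0 ≤ h)
    (H : ∀ a b : A, b * h * a = 0 → b * k * a = 0) {δ : ℝ} (hδ : 0 < δ) (n : ℕ)
    (hn : ‖h‖ ≤ δ * (n + 1)) :
    ‖h * k - k * h‖ ≤ δ * (2 * ‖k‖ + 2 * √(3 * n * ‖k‖ ^ 2)) := by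
  obtain ⟨f, hfsa, hf1, hmul, hsub1, hsubmul, hcomm, hsum⟩ :=
    exists_ramp_decomposition hh hδ (n + 1) (by exact_mod_cast hn)
  have hmul' : ∀ i, f (i + 1) * f i = f (i + 1) := fun i ↦ by
    rw [← hfsa i, ← hfsa (i + 1), ← star_mul, hmul]
  have hloc : ∀ i, k * f (i + 1) = f i * k * f (i + 1) := fun i ↦ by
    rw [← sub_eq_zero]
    refine eq_zero_of_forall_mul_eq_zero fun b ↦ ?_
    have := H (f (i + 1)) (b - b * f i) (by
      rw [mul_assoc, ← hcomm, sub_mul, mul_assoc b, ← mul_assoc (f i), hmul, sub_self])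
    rw [← this]
    simp only [mul_sub, sub_mul, mul_assoc]
  have hloc' : ∀ i, f (i + 1) * k = f (i + 1) * k * f i := fun i ↦ by
    rw [← sub_eq_zero]
    refine eq_zero_of_forall_mul_eq_zero' fun b ↦ ?_
    have := H (b - f i * b) (f (i + 1)) (by
      rw [hcomm, mul_assoc, mul_sub, ← mul_assoc _ _ b, hmul', sub_self, mul_zero])
    rw [← this]
    simp only [mul_sub, sub_mul, mul_assoc]
  have hX : ‖∑ i ∈ Finset.range n, f (i + 1) * k * (f i - f (i + 1))‖ ≤ √(3 * n * ‖k‖ ^ 2) := by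
    apply Real.le_sqrt_of_sq_le
    refine norm_sum_sq_le_of_mul_star_eq_zero (fun i ↦ ?_) (fun i j hij ↦ ?_) n
    · calc _ ≤ ‖f (i + 1)‖ * ‖k‖ * ‖f i - f (i + 1)‖ :=
          (norm_mul_le _ _).trans (by gcongr; exact norm_mul_le _ _)
        _ ≤ 1 * ‖k‖ * 1 := by gcongr; exacts [hf1 _, hsub1 _]
        _ = ‖k‖ := by ring
    · rw [star_mul, star_sub, hfsa, hfsa, mul_assoc, ← mul_assoc (f i - f (i + 1)),
        hsubmul i j hij, zero_mul, mul_zero]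
  have hY : ‖∑ i ∈ Finset.range n, (f i - f (i + 1)) * k * f (i + 1)‖ ≤ √(3 * n * ‖k‖ ^ 2) := by
    apply Real.le_sqrt_of_sq_le
    refine norm_sum_sq_le_of_star_mul_eq_zero (fun i ↦ ?_) (fun i j hij ↦ ?_) n
    · calc _ ≤ ‖f i - f (i + 1)‖ * ‖k‖ * ‖f (i + 1)‖ :=
          (norm_mul_le _ _).trans (by gcongr; exact norm_mul_le _ _)
        _ ≤ 1 * ‖k‖ * 1 := by gcongr; exacts [hsub1 _, hf1 _]
        _ = ‖k‖ := by ring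
    · rw [mul_assoc, mul_assoc _ k, star_mul, star_sub, hfsa, hfsa, mul_assoc,
        ← mul_assoc (f i - f (i + 1)), hsubmul i j hij, zero_mul, mul_zero]
  have hterm : ∀ i, f (i + 1) * k - k * f (i + 1) =
      f (i + 1) * k * (f i - f (i + 1)) - (f i - f (i + 1)) * k * f (i + 1) := fun i ↦ by
    rw [mul_sub, sub_mul, sub_mul, ← hloc, ← hloc']; abel
  have hexp : h * k - k * h = δ • ((f 0 * k - k * f 0) +
      (∑ i ∈ Finset.range n, f (i + 1) * k * (f i - f (i + 1)) -
        ∑ i ∈ Finset.range n, (f i - f (i + 1)) * k * f (i + 1))) := by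
    rw [← Finset.sum_sub_distrib, ← Finset.sum_congr rfl fun i _ ↦ hterm i, add_comm,
      ← Finset.sum_range_succ' (fun i ↦ f i * k - k * f i) n, Finset.sum_sub_distrib,
      ← Finset.sum_mul, ← Finset.mul_sum, smul_sub, ← smul_mul_assoc, ← mul_smul_comm, ← hsum]
  have hzero : ‖f 0 * k - k * f 0‖ ≤ 2 * ‖k‖ := by
    calc _ ≤ ‖f 0‖ * ‖k‖ + ‖k‖ * ‖f 0‖ :=
          (norm_sub_le _ _).trans (add_le_add (norm_mul_le _ _) (norm_mul_le _ _))
      _ ≤ 1 * ‖k‖ + ‖k‖ * 1 := by gcongr <;> exact hf1 0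
      _ = _ := by ring
  rw [hexp, norm_smul, Real.norm_of_nonneg hδ.le]
  gcongr
  refine (norm_add_le _ _).trans (add_le_add hzero ((norm_sub_le _ _).trans ?_))
  linarith

/-- An element `k` which is local with respect to `h ≥ 0` commutes with `h`. -/
lemma commute_of_local {h k : A} (hh : 0 ≤ h)
    (H : ∀ a b : A, b * h * a = 0 → b * k * a = 0) : Commute h k := by
  have hbound : ∀ n : ℕ, ‖h * k - k * h‖ ≤
      ((‖h‖ + 1) * ‖k‖ * 6) / √((n : ℝ) + 1) := fun n ↦ by
    have hn : (0 : ℝ) < n + 1 := by positivity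
    refine (norm_mul_sub_mul_le_of_local hh H (δ := (‖h‖ + 1) / (n + 1)) (by positivity) n
      (by rw [div_mul_cancel₀ _ hn.ne']; linarith)).trans ?_
    have h1 : (1 : ℝ) ≤ √((n : ℝ) + 1) := by rw [Real.one_le_sqrt]; linarith
    have h2 : √(3 * n * ‖k‖ ^ 2) ≤ 2 * √((n : ℝ) + 1) * ‖k‖ := by
      apply Real.sqrt_le_iff.2 ⟨by positivity, ?_⟩
      rw [mul_pow, mul_pow, Real.sq_sqrt hn.le]
      gcongr ?_ * _
      linarith
    have h3 : (n : ℝ) + 1 = √((n : ℝ) + 1) * √((n : ℝ) + 1) := (Real.mul_self_sqrt hn.le).symm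
    calc _ ≤ (‖h‖ + 1) / (n + 1) *
          (2 * (‖k‖ * √((n : ℝ) + 1)) + 2 * (2 * √((n : ℝ) + 1) * ‖k‖)) := by
          gcongr
          exact le_mul_of_one_le_right (norm_nonneg _) h1
      _ = _ := by
          generalize √((n : ℝ) + 1) = s at *
          rw [h3]
          field_simp
          ring
  have hlim : Tendsto (fun n : ℕ ↦ ((‖h‖ + 1) * ‖k‖ * 6) / √((n : ℝ) + 1)) atTop (𝓝 0) :=
    tendsto_const_nhds.div_atTop <| Real.tendsto_sqrt_atTop.comp <|
      tendsto_atTop_add_const_right _ _ tendsto_natCast_atTop_atTop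
  exact sub_eq_zero.1 (norm_le_zero_iff.1 (ge_of_tendsto' hlim hbound))

end Locality

section Truncation

variable {A : Type*} [NonUnitalCStarAlgebra A] [PartialOrder A] [StarOrderedRing A]

/-- A positive element `h` is approximated by elements `g` of its functional calculus on which `h`
is invertible. -/
lemma exists_truncation {h : A} (hh : 0 ≤ h) {ε : ℝ} (hε : 0 < ε) :
    ∃ a g : A, star g = g ∧ a * h * g = g ∧ ‖h - g‖ ≤ ε ∧ ∀ k, Commute h k → Commute g k := by
  have hsa : IsSelfAdjoint h := .of_nonneg hh
  have hmax : ∀ t : ℝ, max t ε ≠ 0 := fun t ↦ (hε.trans_le (le_max_right t ε)).ne'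
  have hac : Continuous fun t : ℝ ↦ t / max t ε ^ 2 :=
    continuous_id.div (by fun_prop) fun t ↦ pow_ne_zero 2 (hmax t)
  have hgc : Continuous fun t : ℝ ↦ max (t - ε) 0 := by fun_prop
  have hg0 : max ((0 : ℝ) - ε) 0 = 0 := max_eq_right (by linarith)
  refine ⟨cfcₙ (fun t : ℝ ↦ t / max t ε ^ 2) h, cfcₙ (fun t : ℝ ↦ max (t - ε) 0) h,
    (cfcₙ_predicate (R := ℝ) _ h : IsSelfAdjoint _), ?_, ?_, fun k hk ↦ hk.cfcₙ_real _⟩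
  · have h1 := cfcₙ_mul (fun t : ℝ ↦ t / max t ε ^ 2) (fun t ↦ t) h hac.continuousOn (by simp)
    rw [cfcₙ_id' ℝ h] at h1
    have hac' : Continuous fun t : ℝ ↦ t / max t ε ^ 2 * t := hac.mul continuous_id
    rw [← h1, ← cfcₙ_mul _ _ h hac'.continuousOn (by simp) hgc.continuousOn hg0]
    congr 1
    ext t
    rcases le_total t ε with ht | ht
    · rw [max_eq_right (b := (0 : ℝ)) (by linarith), mul_zero]
    · rw [max_eq_left ht]
      field_simp [(hε.trans_le ht).ne']
  · have h1 := cfcₙ_sub (fun t : ℝ ↦ t) (fun t : ℝ ↦ max (t - ε) 0) h continuousOn_id rfl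
      hgc.continuousOn hg0
    rw [cfcₙ_id' ℝ h] at h1
    rw [← h1]
    refine norm_cfcₙ_le fun t ht ↦ ?_
    have ht0 : 0 ≤ t := quasispectrum_nonneg_of_nonneg h hh t ht
    rw [Real.norm_eq_abs, abs_le]
    rcases le_total t ε with ht | ht
    · rw [max_eq_right (b := (0 : ℝ)) (by linarith)]
      constructor <;> linarith
    · rw [max_eq_left (b := (0 : ℝ)) (by linarith)]
      constructor <;> linarith

end Truncation

namespace CStarNormedInnerProductModule

variable {A E : Type*} [NonUnitalCStarAlgebra A] [PartialOrder A] [StarOrderedRing A]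
  [NormedAddCommGroup E] [Module ℂ E] [SMul A E] (M : CStarNormedInnerProductModule A E)

lemma add_right (x y z : E) : M.inner x (y + z) = M.inner x y + M.inner x z := by
  rw [← M.star_inner, M.add_left, star_add, M.star_inner, M.star_inner]

lemma smulA_right (a : A) (x y : E) : M.inner x (a • y) = M.inner x y * star a := by
  rw [← M.star_inner, M.smulA_left, star_mul, M.star_inner]

lemma smulC_right (c : ℂ) (x y : E) : M.inner x (c • y) = star c • M.inner x y := by
  rw [← M.star_inner, M.smulC_left, star_smul, M.star_inner]

lemma sub_left (x y z : E) : M.inner (x - y) z = M.inner x z - M.inner y z := by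
  have := M.add_left (x - y) y z
  rw [sub_add_cancel] at this
  rw [this, add_sub_cancel_right]

lemma zero_left (y : E) : M.inner 0 y = 0 := by
  simpa using M.sub_left 0 0 y

lemma sub_right (x y z : E) : M.inner x (y - z) = M.inner x y - M.inner x z := by
  rw [← M.star_inner, M.sub_left, star_sub, M.star_inner, M.star_inner]

lemma inner_eq_zero_symm {x y : E} : M.inner x y = 0 ↔ M.inner y x = 0 := by
  rw [← M.star_inner, star_eq_zero]

lemma eq_of_forall_inner_eq {x y : E} (h : ∀ w, M.inner x w = M.inner y w) : x = y := by
  rw [← sub_eq_zero, ← M.inner_self_eq_zero, M.sub_left, h, sub_self]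

/-- The Mathlib C⋆-module structure, whose inner product is linear in the second variable. -/
abbrev toCStarModule : CStarModule A E where
  inner x y := M.inner y x
  inner_add_right := M.add_left _ _ _
  inner_self_nonneg := M.inner_self_nonneg _
  inner_self := M.inner_self_eq_zero _
  inner_op_smul_right := M.smulA_left _ _ _
  inner_smul_right_complex := M.smulC_left _ _ _
  star_inner _ _ := M.star_inner _ _
  norm_eq_sqrt_norm_inner_self x := by rw [← M.norm_eq, Real.sqrt_sq (norm_nonneg _)]

lemma norm_inner_le (x y : E) : ‖M.inner x y‖ ≤ ‖x‖ * ‖y‖ := by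
  let _ := M.toCStarModule
  rw [mul_comm]
  exact CStarModule.norm_inner_le E (A := A) (x := y) (y := x)

lemma norm_smulA_le (M : CStarNormedInnerProductModule A E) (a : A) (x : E) :
    ‖a • x‖ ≤ ‖a‖ * ‖x‖ := by
  refine (pow_le_pow_iff_left₀ (norm_nonneg _) (by positivity) two_ne_zero).1 ?_
  rw [M.norm_eq, M.smulA_left, M.smulA_right, mul_pow, M.norm_eq x]
  calc _ ≤ ‖a‖ * (‖M.inner x x‖ * ‖star a‖) :=
        (norm_mul_le _ _).trans (by gcongr; exact norm_mul_le _ _)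
    _ = _ := by rw [norm_star]; ring

end CStarNormedInnerProductModule

lemma norm_pow_succ_le_of_isSelfAdjoint {B : Type*} [CStarAlgebra B] {h : B}
    (hh : IsSelfAdjoint h) (n : ℕ) : ‖h‖ ^ (n + 1) ≤ ‖h ^ (n + 1)‖ := by
  rcases eq_or_ne h 0 with rfl | hne
  · simp
  have hpos : 0 < ‖h‖ := norm_pos_iff.2 hne
  obtain ⟨d, hd⟩ := Nat.exists_eq_add_of_lt (Nat.lt_two_pow_self (n := n + 1))
  refine le_of_mul_le_mul_right ?_ (pow_pos hpos (d + 1))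
  calc ‖h‖ ^ (n + 1) * ‖h‖ ^ (d + 1) = ‖h ^ (n + 1) * h ^ (d + 1)‖ := by
        rw [← pow_add, ← pow_add, ← add_assoc, ← hd, hh.norm_pow_two_pow]
    _ ≤ ‖h ^ (n + 1)‖ * ‖h‖ ^ (d + 1) :=
        (norm_mul_le _ _).trans (by gcongr; exact norm_pow_le' _ d.succ_pos)

namespace CStarNormedInnerProductModule

section Faithful

variable {A E : Type*} [NonUnitalCStarAlgebra A] [PartialOrder A] [StarOrderedRing A]
  [NormedAddCommGroup E] [Module ℂ E] [SMul A E] {M : CStarNormedInnerProductModule A E}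

lemma exists_norm_pow_mul_inner_span_le (M : CStarNormedInnerProductModule A E) {h : A} {r : ℝ}
    (hr : 0 ≤ r) (hhr : ∀ u : E, ‖h • u‖ ≤ r * ‖u‖) {s : A}
    (hs : s ∈ Submodule.span ℂ {a : A | ∃ x y : E, a = M.inner x y}) :
    ∃ K, ∀ n : ℕ, ‖(h : Unitization ℂ A) ^ n * (s : Unitization ℂ A)‖ ≤ K * r ^ n := by
  induction hs using Submodule.span_induction with
  | mem s hs =>
    obtain ⟨x, y, rfl⟩ := hs
    have key : ∀ n : ℕ, ∃ z : E, ‖z‖ ≤ r ^ n * ‖x‖ ∧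
        (h : Unitization ℂ A) ^ n * (M.inner x y : Unitization ℂ A) = M.inner z y := fun n ↦ by
      induction n with
      | zero => exact ⟨x, by simp, by simp⟩
      | succ n ih =>
        obtain ⟨z, hz, hz'⟩ := ih
        refine ⟨h • z, (hhr z).trans ?_, ?_⟩
        · rw [pow_succ', mul_assoc]
          gcongr
        · rw [pow_succ', mul_assoc, hz', M.smulA_left, Unitization.inr_mul]
    refine ⟨‖x‖ * ‖y‖, fun n ↦ ?_⟩
    obtain ⟨z, hz, hz'⟩ := key n
    rw [hz', Unitization.norm_inr]
    calc _ ≤ ‖z‖ * ‖y‖ := M.norm_inner_le z y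
      _ ≤ (r ^ n * ‖x‖) * ‖y‖ := by gcongr
      _ = _ := by ring
  | zero => exact ⟨0, by simp⟩
  | add s t _ _ hs ht =>
    obtain ⟨K, hK⟩ := hs
    obtain ⟨L, hL⟩ := ht
    refine ⟨K + L, fun n ↦ ?_⟩
    rw [Unitization.inr_add, mul_add, add_mul]
    exact (norm_add_le _ _).trans (add_le_add (hK n) (hL n))
  | smul c s _ hs =>
    obtain ⟨K, hK⟩ := hs
    refine ⟨‖c‖ * K, fun n ↦ ?_⟩
    rw [Unitization.inr_smul, mul_smul_comm, norm_smul, mul_assoc]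
    gcongr
    exact hK n

/-- The coefficient algebra acts isometrically on a full Hilbert module. -/
lemma IsFull.norm_le_of_forall_norm_smul_le (hM : M.IsFull) {b : A} {c : ℝ} (hc : 0 ≤ c)
    (hb : ∀ u : E, ‖b • u‖ ≤ c * ‖u‖) : ‖b‖ ≤ c := by
  by_contra! hlt
  have hb0 : 0 < ‖b‖ := hc.trans_lt hlt
  set h := star b * b with hdef
  have hnorm : ‖h‖ = ‖b‖ * ‖b‖ := CStarRing.norm_star_mul_self
  have hsa : IsSelfAdjoint (h : Unitization ℂ A) := (IsSelfAdjoint.star_mul_self b).inr ℂ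
  set r := ‖b‖ * c with hr
  have hr0 : 0 ≤ r := by positivity
  have hhr : ∀ u : E, ‖h • u‖ ≤ r * ‖u‖ := fun u ↦ by
    rw [hdef, M.mul_smul, hr, mul_assoc, ← norm_star b]
    exact (M.norm_smulA_le _ _).trans (by gcongr; exact hb u)
  have hrh : r < ‖h‖ := by rw [hnorm, hr]; gcongr
  have hpos : 0 < ‖h‖ := hr0.trans_lt hrh
  have hmem : h ∈ (Submodule.span ℂ {a : A | ∃ x y : E, a = M.inner x y}).topologicalClosure := by
    rw [show _ = ⊤ from hM]; trivial
  obtain ⟨s, hs, hsh⟩ := Metric.mem_closure_iff.1 hmem (‖h‖ / 2) (by positivity)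
  rw [dist_eq_norm] at hsh
  obtain ⟨K, hK⟩ := M.exists_norm_pow_mul_inner_span_le hr0 hhr hs
  have hbound : ∀ n : ℕ, ‖h‖ / 2 ≤ K * (r / ‖h‖) ^ n := fun n ↦ by
    have h1 := norm_pow_succ_le_of_isSelfAdjoint hsa n
    have h2 : ‖(h : Unitization ℂ A) ^ n‖ ≤ ‖h‖ ^ n :=
      (norm_pow_le _ n).trans_eq (by rw [Unitization.norm_inr])
    have h3 : (h : Unitization ℂ A) ^ (n + 1) =
        (h : Unitization ℂ A) ^ n * (s : Unitization ℂ A) +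
          (h : Unitization ℂ A) ^ n * ((h - s : A) : Unitization ℂ A) := by
      rw [Unitization.inr_sub, pow_succ]; noncomm_ring
    have h4 : ‖h‖ ^ (n + 1) ≤ K * r ^ n + ‖h‖ ^ n * (‖h‖ / 2) := by
      rw [Unitization.norm_inr, h3] at h1
      refine h1.trans ((norm_add_le _ _).trans (add_le_add (hK n) ((norm_mul_le _ _).trans ?_)))
      rw [Unitization.norm_inr]
      gcongr
    rw [div_pow, ← mul_div_assoc, le_div_iff₀ (by positivity)]
    rw [pow_succ] at h4
    linarith
  have hlim : Tendsto (fun n : ℕ ↦ K * (r / ‖h‖) ^ n) atTop (𝓝 (K * 0)) :=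
    (tendsto_pow_atTop_nhds_zero_of_lt_one (by positivity) ((div_lt_one hpos).2 hrh)).const_mul K
  have := ge_of_tendsto' hlim hbound
  linarith

end Faithful

section Orthogonality

variable {A E : Type*} [NonUnitalCStarAlgebra A] [PartialOrder A] [StarOrderedRing A]
  [NormedAddCommGroup E] [Module ℂ E] [SMul A E] (M : CStarNormedInnerProductModule A E)
  {T : E → E}

lemma commute_inner_self_inner_map_self (hTsmulA : ∀ (a : A) (x : E), T (a • x) = a • T x)
    (hTS : ∀ x y : E, M.inner x y = 0 → M.inner (T x) y = 0) (u : E) :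
    Commute (M.inner u u) (M.inner (T u) u) := by
  refine commute_of_local (M.inner_self_nonneg u) fun a b hab ↦ ?_
  have := hTS (b • u) (star a • u)
  rw [hTsmulA] at this
  simp only [M.smulA_left, M.smulA_right, star_star, mul_assoc] at this hab ⊢
  exact this hab

lemma inner_map_mul_inner_self (hTadd : ∀ x y : E, T (x + y) = T x + T y)
    (hTsmulA : ∀ (a : A) (x : E), T (a • x) = a • T x)
    (hTS : ∀ x y : E, M.inner x y = 0 → M.inner (T x) y = 0) (x u : E) :
    (M.inner (T x) u * M.inner u u - M.inner x u * M.inner (T u) u) * M.inner u u = 0 := by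
  set c := M.inner x u
  set d := M.inner (T x) u
  set h := M.inner u u
  set k := M.inner (T u) u
  have hTsub : ∀ x y, T (x - y) = T x - T y := fun x y ↦ by
    rw [eq_sub_iff_add_eq, ← hTadd, sub_add_cancel]
  have hhk : Commute h k := M.commute_inner_self_inner_map_self hTsmulA hTS u
  have hbound : ∀ ε : ℝ, 0 < ε →
      ‖(d * h - c * k) * h‖ ≤ ε * (‖d‖ * ‖h‖ + ‖c‖ * ‖k‖) := fun ε hε ↦ by
    obtain ⟨a, g, hg, hag, hgε, hcomm⟩ := exists_truncation (M.inner_self_nonneg u) hε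
    have hgk : g * k = k * g := hcomm k hhk
    have hgh : g * h = h * g := hcomm h (Commute.refl h)
    have horth : d * g = c * a * k * g := by
      have := hTS (x - (c * a) • u) (g • u) (by
        rw [M.smulA_right, hg, M.sub_left, M.smulA_left, sub_mul, mul_assoc c, mul_assoc c, hag,
          sub_self])
      rwa [M.smulA_right, hg, hTsub, hTsmulA, M.sub_left, M.smulA_left, sub_mul, sub_eq_zero]
        at this
    have hdgh : d * g * h = c * g * k := by
      rw [horth, mul_assoc _ g, hgh, mul_assoc _ k, ← mul_assoc k, ← hhk.eq, mul_assoc h, ← hgk]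
      simp only [← mul_assoc]
      rw [mul_assoc c, mul_assoc c, hag]
    have : (d * h - c * k) * h = d * (h - g) * h - c * (h - g) * k := by
      rw [sub_mul, mul_assoc c k, ← hhk.eq, mul_sub, sub_mul, mul_sub, sub_mul, hdgh]
      simp only [mul_assoc]
      abel
    rw [this]
    calc _ ≤ ‖d‖ * ‖h - g‖ * ‖h‖ + ‖c‖ * ‖h - g‖ * ‖k‖ :=
          (norm_sub_le _ _).trans <| add_le_add
            ((norm_mul_le _ _).trans (by gcongr; exact norm_mul_le _ _))
            ((norm_mul_le _ _).trans (by gcongr; exact norm_mul_le _ _))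
      _ ≤ ‖d‖ * ε * ‖h‖ + ‖c‖ * ε * ‖k‖ := by gcongr
      _ = _ := by ring
  have hlim : Tendsto (fun ε : ℝ ↦ ε * (‖d‖ * ‖h‖ + ‖c‖ * ‖k‖)) (𝓝[>] 0) (𝓝 0) := by
    have : Tendsto (fun ε : ℝ ↦ ε * (‖d‖ * ‖h‖ + ‖c‖ * ‖k‖)) (𝓝 0)
        (𝓝 (0 * (‖d‖ * ‖h‖ + ‖c‖ * ‖k‖))) := tendsto_id.mul_const _
    rw [zero_mul] at this
    exact this.mono_left nhdsWithin_le_nhds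
  exact norm_le_zero_iff.1 <| ge_of_tendsto hlim <|
    eventually_nhdsWithin_of_forall fun ε hε ↦ hbound ε hε

lemma inner_map_smul_self (hTadd : ∀ x y : E, T (x + y) = T x + T y)
    (hTsmulA : ∀ (a : A) (x : E), T (a • x) = a • T x)
    (hTS : ∀ x y : E, M.inner x y = 0 → M.inner (T x) y = 0) (x u : E) :
    M.inner (T x) u • u = M.inner x u • T u := by
  set v := M.inner (T x) u • u - M.inner x u • T u with hv
  have hvu : M.inner v u = 0 := by
    have h0 : M.inner v u * M.inner u u = 0 := by
      rw [hv, M.sub_left, M.smulA_left, M.smulA_left]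
      exact M.inner_map_mul_inner_self hTadd hTsmulA hTS x u
    have h1 : M.inner v u • u = 0 := by
      rw [← M.inner_self_eq_zero, M.smulA_right, M.smulA_left, h0, zero_mul]
    have h2 : M.inner v u * star (M.inner v u) = 0 := by
      rw [M.star_inner, ← M.smulA_left, h1, M.zero_left]
    exact (CStarRing.mul_star_self_eq_zero_iff _).1 h2
  have hvTu : M.inner v (T u) = 0 :=
    M.inner_eq_zero_symm.1 (hTS u v (M.inner_eq_zero_symm.1 hvu))
  rw [← sub_eq_zero, ← hv, ← M.inner_self_eq_zero]
  conv_lhs => rw [hv, ← hv]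
  nth_rewrite 2 [hv]
  rw [M.sub_right, M.smulA_right, M.smulA_right, hvu, hvTu, zero_mul, zero_mul, sub_zero]

lemma inner_map_mul_inner (hTadd : ∀ x y : E, T (x + y) = T x + T y)
    (hTsmulC : ∀ (c : ℂ) (x : E), T (c • x) = c • T x)
    (hTsmulA : ∀ (a : A) (x : E), T (a • x) = a • T x)
    (hTS : ∀ x y : E, M.inner x y = 0 → M.inner (T x) y = 0) (x v u w : E) :
    M.inner (T x) v * M.inner u w = M.inner x v * M.inner (T u) w := by
  have hdiag : ∀ u, M.inner (T x) u * M.inner u w - M.inner x u * M.inner (T u) w = 0 := fun u ↦ by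
    rw [← M.smulA_left, ← M.smulA_left, M.inner_map_smul_self hTadd hTsmulA hTS, sub_self]
  have h1 := hdiag (u + v)
  have h2 := hdiag (u + Complex.I • v)
  have hu := hdiag u
  have hv := hdiag v
  simp only [hTadd, hTsmulC, M.add_left, M.add_right, M.smulC_left, M.smulC_right, mul_add, add_mul,
    smul_mul_assoc, mul_smul_comm] at h1 h2
  set p := M.inner (T x) v * M.inner u w - M.inner x v * M.inner (T u) w with hp
  set q := M.inner (T x) u * M.inner v w - M.inner x u * M.inner (T v) w with hq
  have hpq : p + q = 0 := by
    rw [hp, hq]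
    linear_combination (norm := module) h1 - hu - hv
  have hpq' : star Complex.I • p + Complex.I • q = 0 := by
    rw [hp, hq]
    linear_combination (norm := module) h2 - hu - (star Complex.I * Complex.I) • hv
  rw [← sub_eq_zero, ← hp]
  rw [← neg_eq_of_add_eq_zero_right hpq, smul_neg, ← sub_eq_add_neg, ← sub_smul] at hpq'
  exact (smul_eq_zero.1 hpq').resolve_left (by simp [Complex.ext_iff]; norm_num)

end Orthogonality

end CStarNormedInnerProductModule

namespace CStarNormedInnerProductModule

variable {A E : Type*} [NonUnitalCStarAlgebra A] [PartialOrder A] [StarOrderedRing A]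
  [NormedAddCommGroup E] [Module ℂ E] [SMul A E] {M : CStarNormedInnerProductModule A E}
  {T : E → E}

lemma sub_smul' (M : CStarNormedInnerProductModule A E) (a b : A) (x : E) :
    (a - b) • x = a • x - b • x := by
  rw [eq_sub_iff_add_eq, ← M.add_smul, sub_add_cancel]

lemma IsFull.eq_of_forall_smul_eq (hM : M.IsFull) {a b : A} (h : ∀ u : E, a • u = b • u) :
    a = b := by
  rw [← sub_eq_zero, ← norm_le_zero_iff]
  refine hM.norm_le_of_forall_norm_smul_le le_rfl fun u ↦ ?_
  rw [M.sub_smul', h, sub_self, norm_zero, zero_mul]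

/-- If every `a` in the span of the inner products has some `b` with `b • u = a • T u`, then such
`b` depend linearly and continuously on `a`, and exist for all `a`. -/
lemma IsFull.exists_linearMap_smul_eq (hM : M.IsFull) (hTbdd : ∃ C : ℝ, ∀ x : E, ‖T x‖ ≤ C * ‖x‖)
    (hT : ∀ x v u : E, M.inner (T x) v • u = M.inner x v • T u) :
    ∃ L : A →L[ℂ] A, ∀ a u, L a • u = a • T u := by
  obtain ⟨C, hC⟩ := hTbdd
  have hC' : ∀ x, ‖T x‖ ≤ |C| * ‖x‖ := fun x ↦ (hC x).trans (by gcongr; exact le_abs_self C)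
  set S := Submodule.span ℂ {a : A | ∃ x y : E, a = M.inner x y} with hS
  have hex : ∀ a : S, ∃ b : A, ∀ u : E, b • u = (a : A) • T u := by
    rintro ⟨a, ha⟩
    induction ha using Submodule.span_induction with
    | mem a ha =>
      obtain ⟨x, y, rfl⟩ := ha
      exact ⟨M.inner (T x) y, hT x y⟩
    | zero => exact ⟨0, fun u ↦ by
        simpa using M.sub_smul' 0 0 u |>.trans (sub_self _) |>.trans
          ((M.sub_smul' 0 0 (T u)).trans (sub_self _)).symm⟩
    | add a b _ _ ha hb =>
      obtain ⟨a', ha'⟩ := ha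
      obtain ⟨b', hb'⟩ := hb
      exact ⟨a' + b', fun u ↦ by simp only [M.add_smul, ha', hb']⟩
    | smul c a _ ha =>
      obtain ⟨a', ha'⟩ := ha
      exact ⟨c • a', fun u ↦ by simp only [M.smul_assoc, ha']⟩
  choose f hf using hex
  let F : S →ₗ[ℂ] A :=
    { toFun := f
      map_add' := fun a b ↦ hM.eq_of_forall_smul_eq fun u ↦ by
        simp only [M.add_smul, hf, Submodule.coe_add]
      map_smul' := fun c a ↦ hM.eq_of_forall_smul_eq fun u ↦ by
        simp only [M.smul_assoc, hf, Submodule.coe_smul, RingHom.id_apply] }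
  have hF : ∃ C, ∀ a, ‖F a‖ ≤ C * ‖S.subtype a‖ := ⟨|C|, fun a ↦
    hM.norm_le_of_forall_norm_smul_le (by positivity) fun u ↦ by
      rw [show F a • u = (a : A) • T u from hf a u]
      calc _ ≤ ‖(a : A)‖ * (|C| * ‖u‖) := (M.norm_smulA_le _ _).trans (by gcongr; exact hC' u)
        _ = |C| * ‖S.subtype a‖ * ‖u‖ := by rw [Submodule.subtype_apply]; ring⟩
  have hdense : DenseRange S.subtype := by
    rw [DenseRange, Submodule.coe_subtype, Subtype.range_coe]
    exact Submodule.dense_iff_topologicalClosure_eq_top.2 hM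
  refine ⟨F.extendOfNorm S.subtype, fun a u ↦ M.eq_of_forall_inner_eq fun w ↦ ?_⟩
  rw [M.smulA_left, M.smulA_left]
  refine hdense.induction_on a (isClosed_eq (by fun_prop) (by fun_prop)) fun s ↦ ?_
  rw [LinearMap.extendOfNorm_eq hdense hF, ← M.smulA_left, ← M.smulA_left]
  exact congrArg (M.inner · w) (hf s u)

end CStarNormedInnerProductModule

/-- A continuous bimodule endomorphism of a C⋆-algebra is given by a central multiplier. -/
lemma exists_mem_center_forall_fst_eq {A : Type*} [NonUnitalCStarAlgebra A] (L : A →L[ℂ] A)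
    (hleft : ∀ a b, L (a * b) = a * L b) (hright : ∀ a b, L (a * b) = L a * b) :
    ∃ γ : 𝓜(ℂ, A), γ ∈ Set.center 𝓜(ℂ, A) ∧ ∀ a, γ.fst a = L a := by
  refine ⟨⟨(L, L), fun x y ↦ by rw [← hright, ← hleft]⟩, ?_, fun _ ↦ rfl⟩
  rw [Semigroup.mem_center_iff]
  refine fun m ↦ DoubleCentralizer.ext ℂ A _ _ (Prod.ext ?_ ?_)
  · ext a
    change m.fst (L a) = L (m.fst a)
    rw [← sub_eq_zero]
    refine eq_zero_of_forall_mul_eq_zero fun c ↦ ?_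
    rw [mul_sub, ← hleft, ← m.central, ← m.central, hleft, sub_self]
  · ext a
    change L (m.snd a) = m.snd (L a)
    rw [← sub_eq_zero]
    refine eq_zero_of_forall_mul_eq_zero' fun c ↦ ?_
    rw [sub_mul, ← hright, m.central, m.central, hright, sub_self]

/-- **Corollary 4.2**: if `T` is a bounded `A`-linear map on a full Hilbert `A`-module such
that `⟪x, y⟫ = 0` implies `⟪T x, y⟫ = 0`, then `T` acts as multiplication by a central
multiplier `γ ∈ Z(M(A))`: `⟪T x, y⟫ = γ · ⟪x, y⟫` for all `x, y` (where `γ` acts on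
`A ⊴ M(A)` via `γ.fst`). -/
theorem full_orthogonality_preserving_central_multiplier
    {A E : Type*} [NonUnitalCStarAlgebra A] [PartialOrder A] [StarOrderedRing A]
    [NormedAddCommGroup E] [Module ℂ E] [SMul A E] [CompleteSpace E]
    (ME : CStarNormedInnerProductModule A E) (hEfull : ME.IsFull)
    (T : E → E)
    (hTadd : ∀ x y : E, T (x + y) = T x + T y)
    (hTsmulC : ∀ (c : ℂ) (x : E), T (c • x) = c • T x)
    (hTsmulA : ∀ (a : A) (x : E), T (a • x) = a • T x)
    (hTbdd : ∃ C : ℝ, ∀ x : E, ‖T x‖ ≤ C * ‖x‖)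
    (hTS : ∀ x y : E, ME.inner x y = 0 → ME.inner (T x) y = 0) :
    ∃ γ : 𝓜(ℂ, A), γ ∈ Set.center 𝓜(ℂ, A) ∧
      ∀ x y : E, ME.inner (T x) y = γ.fst (ME.inner x y) := by
  obtain ⟨L, hL⟩ := hEfull.exists_linearMap_smul_eq hTbdd fun x v u ↦
    ME.eq_of_forall_inner_eq fun w ↦ by
      rw [ME.smulA_left, ME.smulA_left, ME.inner_map_mul_inner hTadd hTsmulC hTsmulA hTS]
  obtain ⟨γ, hγ, hγL⟩ := exists_mem_center_forall_fst_eq L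
    (fun a b ↦ hEfull.eq_of_forall_smul_eq fun u ↦ by
      rw [hL, ME.mul_smul, ME.mul_smul, hL])
    (fun a b ↦ hEfull.eq_of_forall_smul_eq fun u ↦ by
      rw [hL, ME.mul_smul, ME.mul_smul, hL, hTsmulA])
  refine ⟨γ, hγ, fun x y ↦ ?_⟩
  rw [hγL]
  refine hEfull.eq_of_forall_smul_eq fun u ↦ ME.eq_of_forall_inner_eq fun w ↦ ?_
  rw [hL, ME.smulA_left, ME.smulA_left, ME.inner_map_mul_inner hTadd hTsmulC hTsmulA hTS]
end
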